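/- arXiv:math/0306397 — 2 statements merged into one kernel-verified Lean document; each statement's English description precedes it below -/
import Mathlib

section
/- Let n be a natural number and let β be a rational number. Then the evaluated cycle index Z(S_n; 0, β, 0, β, …) of S_n at the substitution x(k) = 0 for k odd and x(k) = β for k even equals 0 if n is odd, and equals (−1)^m · Ring.choose(−β/2, m) if n = 2m is even. Equivalently, only permutations all of whose cycles have even length (in particular, with no fixed points) contribute to the sum, and (1/n!) · Σ_{π ∈ S_n, all cycle lengths of π even} β^{c(π)} equals the coefficient of t^n in (1−t²)^{−β/2}, where c(π) is the total number of cycles of π. -/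
/- `cycCount π k` is the number of cycles of length `k` in the cycle decomposition of the
permutation `π` of a finite type, where fixed points are counted as cycles of length `1`. -/
def cycCount {α : Type*} [Fintype α] [DecidableEq α] (π : Equiv.Perm α) (k : ℕ) : ℕ :=
  if k = 1 then Fintype.card α - π.support.card else π.cycleType.count k

/- The evaluated cycle index `Z(G; x)` of a subgroup `G` of the permutations of a finite
type `α`: `(1/|G|) · Σ_{π ∈ G} Π_{k=1}^{card α} x(k)^{c_k(π)}`. -/
open scoped Classical in
noncomputable def cycleIndex {α : Type*} [Fintype α] [DecidableEq α]
    (G : Subgroup (Equiv.Perm α)) (x : ℕ → ℚ) : ℚ :=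
  (1 / (Nat.card G : ℚ)) *
    ∑ π ∈ Finset.univ.filter (fun π => π ∈ G),
      ∏ k ∈ Finset.Icc 1 (Fintype.card α), x k ^ cycCount π k

/-- The order of the centralizer of a permutation whose multiset of cycle lengths, fixed points
included, is `s`. -/
def centralizerOrder (s : Multiset ℕ) : ℕ :=
  s.prod * ∏ k ∈ s.toFinset, (s.count k).factorial

theorem centralizerOrder_cons (a : ℕ) (s : Multiset ℕ) :
    centralizerOrder (a ::ₘ s) = a * (a ::ₘ s).count a * centralizerOrder s := by
  have h : ∏ k ∈ s.toFinset, (s.count k).factorial =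
      ∏ k ∈ (a ::ₘ s).toFinset, (s.count k).factorial := by
    refine Finset.prod_subset (by simp) fun k _ hk => ?_
    rw [Multiset.count_eq_zero_of_notMem (by simpa using hk), Nat.factorial_zero]
  have ha : a ∈ (a ::ₘ s).toFinset := by simp
  have h_erase : ∏ k ∈ (a ::ₘ s).toFinset.erase a, ((a ::ₘ s).count k).factorial =
      ∏ k ∈ (a ::ₘ s).toFinset.erase a, (s.count k).factorial :=
    Finset.prod_congr rfl fun k hk => by
      rw [Multiset.count_cons_of_ne (Finset.ne_of_mem_erase hk)]
  rw [centralizerOrder, centralizerOrder, h, ← Finset.mul_prod_erase _ _ ha,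
    ← Finset.mul_prod_erase _ _ ha, h_erase, Multiset.count_cons_self, Nat.factorial_succ,
    Multiset.prod_cons]
  ring

theorem centralizerOrder_add_replicate_one {m : Multiset ℕ} (hm : 1 ∉ m) (r : ℕ) :
    centralizerOrder (m + Multiset.replicate r 1) = r.factorial * centralizerOrder m := by
  induction r with
  | zero => simp
  | succ r ih =>
    rw [Multiset.replicate_succ, Multiset.add_cons, centralizerOrder_cons, ih,
      Multiset.count_cons_self, Multiset.count_add, Multiset.count_eq_zero_of_notMem hm,
      Multiset.count_replicate_self, Nat.factorial_succ]
    ring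

theorem Nat.Partition.centralizerOrder_pos {n : ℕ} (q : n.Partition) :
    0 < centralizerOrder q.parts :=
  Nat.mul_pos (Multiset.prod_pos fun _ h => q.parts_pos h)
    (Finset.prod_pos fun _ _ => Nat.factorial_pos _)

section Perm

variable {α : Type*} [Fintype α] [DecidableEq α]

theorem Nat.Partition.parts_eq_filter_add_replicate {n : ℕ} (q : n.Partition) :
    q.parts = q.parts.filter (2 ≤ ·) +
      Multiset.replicate (n - (q.parts.filter (2 ≤ ·)).sum) 1 := by
  have h_rep : q.parts.filter (¬ 2 ≤ ·) =
      Multiset.replicate (q.parts.filter (¬ 2 ≤ ·)).card 1 := by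
    refine Multiset.eq_replicate_card.2 fun b hb => ?_
    have := q.parts_pos (Multiset.mem_of_mem_filter hb)
    have := Multiset.of_mem_filter hb
    omega
  have h_add := Multiset.filter_add_not (2 ≤ ·) q.parts
  have h_sum := congrArg Multiset.sum h_add
  rw [Multiset.sum_add, q.parts_sum, h_rep, Multiset.sum_replicate, smul_eq_mul, mul_one] at h_sum
  rw [show n - (q.parts.filter (2 ≤ ·)).sum = (q.parts.filter (¬ 2 ≤ ·)).card by omega, ← h_rep,
    h_add]

theorem Equiv.Perm.partition_eq_iff (π : Equiv.Perm α) (q : (Fintype.card α).Partition) :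
    π.partition = q ↔ π.cycleType = q.parts.filter (2 ≤ ·) := by
  constructor
  · rintro rfl
    exact filter_parts_partition_eq_cycleType.symm
  · intro h
    rw [Nat.Partition.ext_iff, parts_partition, ← sum_cycleType, h]
    exact q.parts_eq_filter_add_replicate.symm

theorem Equiv.Perm.card_partition_eq_mul_centralizerOrder (q : (Fintype.card α).Partition) :
    (Finset.univ.filter fun π : Equiv.Perm α => π.partition = q).card *
      centralizerOrder q.parts = (Fintype.card α).factorial := by
  have h_le : (q.parts.filter (2 ≤ ·)).sum ≤ Fintype.card α := by
    have h := congrArg Multiset.sum (Multiset.filter_add_not (2 ≤ ·) q.parts)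
    rw [Multiset.sum_add, q.parts_sum] at h
    omega
  have h_card := card_of_cycleType_mul_eq α (q.parts.filter (2 ≤ ·))
  rw [if_pos ⟨h_le, fun a ha => Multiset.of_mem_filter ha⟩] at h_card
  have h_one : 1 ∉ q.parts.filter (2 ≤ ·) := by simp
  simp_rw [partition_eq_iff]
  rw [← h_card, q.parts_eq_filter_add_replicate, centralizerOrder_add_replicate_one h_one,
    ← q.parts_eq_filter_add_replicate, centralizerOrder]
  ring

theorem cycCount_eq_count_partition (π : Equiv.Perm α) (k : ℕ) :
    cycCount π k = π.partition.parts.count k := by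
  rw [cycCount, Equiv.Perm.parts_partition, Multiset.count_add, Multiset.count_replicate]
  split_ifs with h h' h'
  · rw [Multiset.count_eq_zero_of_notMem, zero_add]
    intro hk
    have := Equiv.Perm.two_le_of_mem_cycleType hk
    omega
  · omega
  · omega
  · simp

theorem prod_pow_cycCount (x : ℕ → ℚ) (π : Equiv.Perm α) :
    ∏ k ∈ Finset.Icc 1 (Fintype.card α), x k ^ cycCount π k =
      (π.partition.parts.map x).prod := by
  simp_rw [cycCount_eq_count_partition]
  rw [Finset.prod_multiset_map_count]
  refine (Finset.prod_subset (fun k hk => ?_) fun k _ hk => ?_).symm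
  · rw [Multiset.mem_toFinset] at hk
    exact Finset.mem_Icc.2 ⟨π.partition.parts_pos hk, π.partition.le_of_mem_parts hk⟩
  · rw [Multiset.count_eq_zero_of_notMem (by simpa using hk), pow_zero]

end Perm

/-- The evaluated cycle index of the symmetric group of degree `n`, as a sum over the partitions
of `n`. -/
noncomputable def partitionCycleIndex (x : ℕ → ℚ) (n : ℕ) : ℚ :=
  ∑ q : n.Partition, (q.parts.map x).prod / centralizerOrder q.parts

theorem cycleIndex_top_eq_partitionCycleIndex {α : Type*} [Fintype α] [DecidableEq α]
    (x : ℕ → ℚ) :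
    cycleIndex (⊤ : Subgroup (Equiv.Perm α)) x = partitionCycleIndex x (Fintype.card α) := by
  have h_card : Nat.card (⊤ : Subgroup (Equiv.Perm α)) = (Fintype.card α).factorial := by
    rw [Subgroup.card_top, Nat.card_eq_fintype_card, Fintype.card_perm]
  rw [cycleIndex, h_card]
  simp only [Subgroup.mem_top, Finset.filter_true, prod_pow_cycCount]
  rw [← Finset.sum_fiberwise Finset.univ (fun π : Equiv.Perm α => π.partition), Finset.mul_sum,
    partitionCycleIndex]
  refine Finset.sum_congr rfl fun q _ => ?_
  rw [Finset.sum_congr rfl (g := fun _ => (q.parts.map x).prod)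
    fun π hπ => by rw [(Finset.mem_filter.1 hπ).2], Finset.sum_const, nsmul_eq_mul]
  have h := Equiv.Perm.card_partition_eq_mul_centralizerOrder q
  have h_fact : ((Fintype.card α).factorial : ℚ) ≠ 0 := by positivity
  have h_order : (centralizerOrder q.parts : ℚ) ≠ 0 := by
    exact_mod_cast q.centralizerOrder_pos.ne'
  rw [← h] at h_fact ⊢
  push_cast at h_fact ⊢
  field_simp [left_ne_zero_of_mul h_fact]

theorem mul_partitionCycleIndex (x : ℕ → ℚ) (n : ℕ) :
    n * partitionCycleIndex x n =
      ∑ k ∈ Finset.Icc 1 n, x k * partitionCycleIndex x (n - k) := by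
  have h_parts (q : n.Partition) :
      (n : ℚ) = ∑ k ∈ Finset.Icc 1 n, (k : ℚ) * q.parts.count k := by
    have h : n = ∑ k ∈ Finset.Icc 1 n, k * q.parts.count k := by
      conv_lhs => rw [← q.parts_sum, Finset.sum_multiset_count]
      simp_rw [smul_eq_mul, mul_comm]
      refine Finset.sum_subset (fun k hk => ?_) fun k _ hk => ?_
      · rw [Multiset.mem_toFinset] at hk
        exact Finset.mem_Icc.2 ⟨q.parts_pos hk, q.le_of_mem_parts hk⟩
      · rw [Multiset.count_eq_zero_of_notMem (by simpa using hk), mul_zero]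
    exact_mod_cast h
  rw [partitionCycleIndex, Finset.mul_sum]
  rw [Finset.sum_congr rfl fun q _ => by rw [h_parts q, Finset.sum_mul], Finset.sum_comm]
  refine Finset.sum_congr rfl fun k hk => ?_
  obtain ⟨hk1, hkn⟩ := Finset.mem_Icc.1 hk
  set f : n.Partition → ℚ := fun q =>
    (k : ℚ) * q.parts.count k * ((q.parts.map x).prod / centralizerOrder q.parts) with hf
  have h_zero (q : n.Partition) (hq : k ∉ q.parts) : f q = 0 := by
    rw [hf]
    simp [Multiset.count_eq_zero_of_notMem hq]
  calc ∑ q, f q = ∑ q with k ∈ q.parts, f q :=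
        (Finset.sum_filter_of_ne fun q _ hq => not_not.1 fun h => hq (h_zero q h)).symm
    _ = ∑ p : {q : n.Partition // k ∈ q.parts}, f p.1 :=
        Finset.sum_subtype _ (by simp) f
    _ = ∑ q : (n - k).Partition, x k * ((q.parts.map x).prod / centralizerOrder q.parts) := by
        rw [← (Nat.Partition.partitionWithPartEquiv hk1 hkn).symm.sum_comp]
        refine Finset.sum_congr rfl fun q _ => ?_
        have h_order : (centralizerOrder q.parts : ℚ) ≠ 0 := by
          exact_mod_cast q.centralizerOrder_pos.ne'
        have h_k : (k : ℚ) ≠ 0 := by positivity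
        have h_count : ((k ::ₘ q.parts).count k : ℚ) ≠ 0 := by
          rw [Multiset.count_cons_self]
          positivity
        simp only [hf, Nat.Partition.partitionWithPartEquiv_symm_apply_parts,
          centralizerOrder_cons, Multiset.map_cons, Multiset.prod_cons, Nat.cast_mul]
        field_simp
    _ = x k * partitionCycleIndex x (n - k) := by
        rw [partitionCycleIndex, Finset.mul_sum]

theorem Ring.succ_mul_choose_succ (r : ℚ) (m : ℕ) :
    (m + 1) * Ring.choose r (m + 1) = (r - m) * Ring.choose r m := by
  have h := Ring.choose_smul_choose r (Nat.le_succ m)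
  rw [Nat.succ_eq_add_one, Nat.choose_succ_self_right, Nat.add_sub_cancel_left,
    Ring.choose_one_right, nsmul_eq_mul] at h
  push_cast at h
  rw [h, mul_comm]

theorem partitionCycleIndex_zero (x : ℕ → ℚ) : partitionCycleIndex x 0 = 1 := by
  simp [partitionCycleIndex, centralizerOrder]

theorem partitionCycleIndex_even_succ_succ (β : ℚ) (n : ℕ) :
    (n + 2) * partitionCycleIndex (fun k => if Odd k then 0 else β) (n + 2) =
      (n + β) * partitionCycleIndex (fun k => if Odd k then 0 else β) n := by
  have h := mul_partitionCycleIndex (fun k => if Odd k then 0 else β) (n + 2)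
  have h' := mul_partitionCycleIndex (fun k => if Odd k then 0 else β) n
  rw [← Finset.Ico_add_one_right_eq_Icc, Finset.sum_Ico_eq_sum_range] at h h'
  rw [show n + 2 + 1 - 1 = n + 1 + 1 by omega, Finset.sum_range_succ', Finset.sum_range_succ'] at h
  rw [Nat.add_sub_cancel] at h'
  have h_shift : ∀ i, n + 2 - (1 + (i + 1 + 1)) = n - (1 + i) := by omega
  have h_odd : ∀ i, Odd (1 + (i + 1 + 1)) ↔ Odd (1 + i) := by
    intro i
    simp only [Nat.odd_iff]
    omega
  simp only [h_shift, h_odd] at h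
  rw [← h'] at h
  norm_num at h
  linear_combination h

theorem partitionCycleIndex_even_of_odd (β : ℚ) (m : ℕ) :
    partitionCycleIndex (fun k => if Odd k then 0 else β) (2 * m + 1) = 0 := by
  induction m with
  | zero => simpa using mul_partitionCycleIndex (fun k => if Odd k then 0 else β) 1
  | succ m ih =>
    have h := partitionCycleIndex_even_succ_succ β (2 * m + 1)
    rw [ih, mul_zero] at h
    exact (mul_eq_zero.1 h).resolve_left (by positivity)

theorem partitionCycleIndex_even_of_even (β : ℚ) (m : ℕ) :
    partitionCycleIndex (fun k => if Odd k then 0 else β) (2 * m) =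
      (-1 : ℚ) ^ m * Ring.choose (-β / 2) m := by
  induction m with
  | zero => simp [partitionCycleIndex_zero]
  | succ m ih =>
    have h := partitionCycleIndex_even_succ_succ β (2 * m)
    have h_choose := Ring.succ_mul_choose_succ (-β / 2) m
    rw [ih] at h
    push_cast at h
    have h_ne : (2 * m + 2 : ℚ) ≠ 0 := by positivity
    refine mul_left_cancel₀ h_ne ?_
    rw [mul_add_one 2 m, h, pow_succ]
    linear_combination 2 * (-1 : ℚ) ^ m * h_choose

/-- `Z(S_n; 0, β, 0, β, …)` equals `0` if `n` is odd and equals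
`(−1)^m · Ring.choose(−β/2, m)` if `n = 2m` is even. -/
theorem cycleIndex_symm_even_substitution (n : ℕ) (β : ℚ) :
    (Odd n →
      cycleIndex (⊤ : Subgroup (Equiv.Perm (Fin n))) (fun k => if Odd k then 0 else β) = 0) ∧
    (∀ m : ℕ, n = 2 * m →
      cycleIndex (⊤ : Subgroup (Equiv.Perm (Fin n))) (fun k => if Odd k then 0 else β) =
        (-1 : ℚ) ^ m * Ring.choose (-β / 2) m) := by
  rw [cycleIndex_top_eq_partitionCycleIndex, Fintype.card_fin]
  constructor
  · rintro ⟨m, rfl⟩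
    exact partitionCycleIndex_even_of_odd β m
  · rintro m rfl
    exact partitionCycleIndex_even_of_even β m
end

section
/- (Combinatorial form of the Hirzebruch-type formula.) Let k, m ≥ 1 and let τ, χ be rational numbers. Set a := Z(S_m; τ, χ, τ, χ, …) (the evaluated cycle index of S_m at x(r) = τ for r odd and x(r) = χ for r even) and b := (−1)^m · Ring.choose(−χ, m). Let G = S_k ≀ S_m be the wreath product, realized as the subgroup of permutations of Fin k × Fin m consisting of all σ for which there exist a permutation ρ of Fin k and τ' : Fin k → S_m with σ(i, j) = (ρ(i), τ'(i)(j)). Then Z(S_k ≀ S_m; τ, χ, τ, χ, …) = Σ_{i=0}^{k} Ring.choose((a−b)/2, i) · (−1)^{k−i} · Ring.choose(−(a+b)/2, k−i); equivalently, Z(S_k ≀ S_m; τ, χ, τ, χ, …) is the coefficient of t^k in the formal power series (1−t²)^{(1/2)(−1)^{m+1}·Ring.choose(−χ, m)} · ((1+t)/(1−t))^{a/2}. -/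
/- The wreath product `S_k ≀ H`, realized as the subgroup of the permutations of
`Fin k × Fin m` consisting of all `σ` for which there exist a permutation `ρ` of `Fin k`
and a function `τ : Fin k → H` with `σ (i, j) = (ρ i, τ i j)` for all `(i, j)`. -/
def wreath (k m : ℕ) (H : Subgroup (Equiv.Perm (Fin m))) :
    Subgroup (Equiv.Perm (Fin k × Fin m)) where
  carrier := {σ | ∃ (ρ : Equiv.Perm (Fin k)) (τ : Fin k → H),
    ∀ i j, σ (i, j) = (ρ i, (τ i : Equiv.Perm (Fin m)) j)}
  one_mem' := ⟨1, fun _ => 1, fun _ _ => rfl⟩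
  mul_mem' := by
    rintro σ₁ σ₂ ⟨ρ₁, τ₁, h₁⟩ ⟨ρ₂, τ₂, h₂⟩
    refine ⟨ρ₁ * ρ₂, fun i => τ₁ (ρ₂ i) * τ₂ i, fun i j => ?_⟩
    simp [Equiv.Perm.mul_apply, h₂, h₁]
  inv_mem' := by
    rintro σ ⟨ρ, τ, h⟩
    refine ⟨ρ⁻¹, fun i => (τ (ρ⁻¹ i))⁻¹, fun i j => ?_⟩
    rw [Equiv.Perm.inv_def, Equiv.symm_apply_eq, h]
    simp

open Equiv Equiv.Perm Finset

theorem prod_pow_cycCount_s7 {α : Type*} [Fintype α] [DecidableEq α] (π : Perm α) (x : ℕ → ℚ) :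
    ∏ k ∈ Icc 1 (Fintype.card α), x k ^ cycCount π k =
      x 1 ^ (Fintype.card α - #π.support) * (π.cycleType.map x).prod := by
  rw [Finset.prod_multiset_map_count]
  have hsub : π.cycleType.toFinset ⊆ (Icc 1 (Fintype.card α)).erase 1 := by
    intro n hn
    rw [Multiset.mem_toFinset] at hn
    have h2 := two_le_of_mem_cycleType hn
    have h3 : n ≤ Fintype.card α :=
      (le_card_support_of_mem_cycleType hn).trans (card_le_univ _)
    simp only [mem_erase, mem_Icc]
    omega
  rw [prod_subset hsub fun n _ hn => by
    rw [Multiset.mem_toFinset] at hn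
    rw [Multiset.count_eq_zero_of_notMem hn, pow_zero]]
  rcases Nat.eq_zero_or_pos (Fintype.card α) with h0 | hpos
  · simp [h0]
  · rw [← mul_prod_erase _ _ (mem_Icc.2 ⟨le_rfl, hpos⟩)]
    congr 1
    refine prod_congr rfl fun n hn => ?_
    rw [cycCount, if_neg (ne_of_mem_erase hn)]

open scoped Classical in
theorem prod_sameCycle_quotient {α : Type*} [Fintype α] [DecidableEq α] (π : Perm α)
    (x : ℕ → ℚ) :
    ∏ o : Quotient (SameCycle.setoid π), x #{n | Quotient.mk (SameCycle.setoid π) n = o} =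
      x 1 ^ (Fintype.card α - #π.support) * (π.cycleType.map x).prod := by
  have hcls (n : α) (hn : π n ≠ n) :
      ({i | Quotient.mk (SameCycle.setoid π) i = Quotient.mk (SameCycle.setoid π) n} : Finset α)
        = (π.cycleOf n).support := by
    ext i
    rw [mem_filter_univ, Quotient.eq, mem_support_cycleOf_iff' hn]
    exact ⟨SameCycle.symm, SameCycle.symm⟩
  have hfix (n : α) (hn : π n = n) :
      ({i | Quotient.mk (SameCycle.setoid π) i = Quotient.mk (SameCycle.setoid π) n} : Finset α)
        = {n} := by
    ext i
    rw [mem_filter_univ, Quotient.eq, mem_singleton]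
    constructor
    · intro h
      exact ((SameCycle.symm h).eq_of_left hn).symm
    · rintro rfl
      exact SameCycle.refl _ _
  rw [← prod_filter_mul_prod_filter_not univ
    (fun o : Quotient (SameCycle.setoid π) => π o.out = o.out)]
  congr 1
  · rw [prod_congr rfl (g := fun _ => x 1), prod_const]
    · congr 1
      rw [← card_compl]
      refine card_bij (fun o _ => o.out) ?_ ?_ ?_
      · intro o ho
        simpa using ho
      · intro o _ o' _ h
        rw [← o.out_eq, ← o'.out_eq, h]
      · intro n hn
        have hn' : π n = n := by simpa using hn
        have h : (Quotient.mk (SameCycle.setoid π) n).out = n := by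
          have h1 : SameCycle π n (Quotient.mk (SameCycle.setoid π) n).out :=
            SameCycle.symm (Quotient.mk_out (s := SameCycle.setoid π) n)
          exact (h1.eq_of_left hn').symm
        exact ⟨Quotient.mk _ n, by simp [h, hn'], h⟩
    · intro o ho
      have := hfix o.out (by simpa using ho)
      rw [o.out_eq] at this
      rw [this, card_singleton]
  · rw [cycleType_def, Multiset.map_map]
    change _ = ∏ c ∈ π.cycleFactorsFinset, x #c.support
    refine prod_bij (fun o _ => π.cycleOf o.out) ?_ ?_ ?_ ?_
    · intro o ho
      rw [cycleOf_mem_cycleFactorsFinset_iff]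
      simpa using ho
    · intro o ho o' ho' h
      have h1 : SameCycle π o.out o'.out := by
        rw [sameCycle_iff_cycleOf_eq_of_mem_support] <;> simp_all
      rw [← o.out_eq, ← o'.out_eq]
      exact Quotient.sound h1
    · intro c hc
      obtain ⟨n, hn⟩ : c.support.Nonempty :=
        nonempty_iff_ne_empty.2 <| mt support_eq_empty_iff.1 (mem_cycleFactorsFinset_iff.1 hc).1.ne_one
      have hc' := cycle_is_cycleOf hn hc
      have h1 : SameCycle π (Quotient.mk (SameCycle.setoid π) n).out n :=
        Quotient.mk_out (s := SameCycle.setoid π) n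
      have h2 : π.cycleOf (Quotient.mk (SameCycle.setoid π) n).out = c := by
        rw [hc', h1.cycleOf_eq]
      refine ⟨Quotient.mk _ n, ?_, h2⟩
      rw [mem_filter_univ, ← cycleOf_eq_one_iff, h2]
      exact (mem_cycleFactorsFinset_iff.1 hc).1.ne_one
    · intro o ho
      have := hcls o.out (by simpa using ho)
      rw [o.out_eq] at this
      rw [this]

open scoped Classical in
/-- The weighted number of colorings invariant under a permutation is a product of power sums. -/
theorem sum_invariant_colorings {α I : Type*} [Fintype α] [DecidableEq α] [Fintype I]
    (π : Perm α) (ε : I → ℚ) :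
    ∑ f : α → I with f ∘ π = f, ∏ n, ε (f n) =
      ∏ k ∈ Icc 1 (Fintype.card α), (∑ i, ε i ^ k) ^ cycCount π k := by
  rw [prod_pow_cycCount_s7 π (fun k => ∑ i, ε i ^ k),
    ← prod_sameCycle_quotient π (fun k => ∑ i, ε i ^ k)]
  rw [prod_univ_sum, Fintype.piFinset_univ]
  symm
  refine sum_bij (fun g _ n => g (Quotient.mk _ n)) ?_ ?_ ?_ ?_
  · intro g _
    rw [mem_filter_univ]
    ext n
    exact congrArg g (Quotient.sound (s := SameCycle.setoid π)
      (sameCycle_apply_left.2 (SameCycle.refl _ _)))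
  · intro g _ g' _ h
    ext o
    induction o using Quotient.inductionOn with
    | h n => exact congrFun h n
  · intro f hf
    rw [mem_filter_univ] at hf
    have hpow (j : ℤ) : ∀ n, f ((π ^ j) n) = f n := by
      induction j using Int.induction_on with
      | zero => simp
      | succ j ih =>
        intro n
        rw [add_comm, zpow_add, zpow_one, Perm.mul_apply]
        exact (congrFun hf _).trans (ih n)
      | pred j ih =>
        intro n
        rw [← ih n, ← congrFun hf ((π ^ (-(j : ℤ) - 1)) n), Function.comp_apply,
          ← Perm.mul_apply, ← zpow_one_add, add_sub_cancel]
    refine ⟨Quotient.lift f ?_, mem_univ _, rfl⟩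
    rintro n n' ⟨j, rfl⟩
    exact (hpow j n).symm
  · intro g _
    rw [← Fintype.prod_fiberwise (Quotient.mk (SameCycle.setoid π))]
    refine prod_congr rfl fun o _ => ?_
    rw [prod_congr rfl (g := fun _ => ε (g o)) fun n _ =>
      congrArg (fun o => ε (g o)) n.2, prod_const,
      card_univ, Fintype.card_subtype]

open PowerSeries in
theorem hsymm_eq_coeff_prod {J : Type*} [Fintype J] [DecidableEq J] (ε : J → ℚ) (k : ℕ) :
    ∑ y : Sym J k, (y.1.map ε).prod = coeff k (∏ j, PowerSeries.mk fun n => ε j ^ n) := by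
  rw [coeff_prod]
  simp only [coeff_mk]
  refine sum_bij (fun y _ => Multiset.toFinsupp y.1) ?_ ?_ ?_ ?_
  · intro y _
    rw [mem_finsuppAntidiag]
    refine ⟨?_, subset_univ _⟩
    change ∑ a, y.1.count a = k
    rw [Multiset.sum_count_eq_card fun a _ => mem_univ a, y.2]
  · intro y _ y' _ h
    exact Subtype.ext (Multiset.toFinsupp.injective h)
  · intro l hl
    rw [mem_finsuppAntidiag] at hl
    refine ⟨⟨Multiset.toFinsupp.symm l, ?_⟩, mem_univ _, by simp⟩
    rw [← hl.1, ← Multiset.sum_count_eq_card fun a _ => mem_univ a]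
    simp
  · intro y _
    rw [Finset.prod_multiset_map_count]
    simp only [Multiset.toFinsupp_apply]
    refine prod_subset (subset_univ _) fun j _ hj => ?_
    rw [Multiset.count_eq_zero_of_notMem (by simpa using hj), pow_zero]

open PowerSeries in
theorem coeff_prod_signs {J : Type*} [Fintype J] (ε : J → ℚ)
    (hε : ∀ j, ε j = 1 ∨ ε j = -1) (k : ℕ) (a b : ℚ) (ha : ∑ j, ε j = a)
    (hb : (Fintype.card J : ℚ) = b) :
    coeff k (∏ j, PowerSeries.mk fun n => ε j ^ n) =
      ∑ i ∈ range (k + 1), Ring.choose ((a - b) / 2) i * (-1 : ℚ) ^ (k - i) *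
          Ring.choose (-(a + b) / 2) (k - i) := by
  classical
  set p := #{j | ε j = 1} with hp
  set q := #{j | ¬ ε j = 1} with hq
  have hneg (j : J) (hj : ¬ ε j = 1) : ε j = -1 := (hε j).resolve_left hj
  have hb' : b = p + q := by
    rw [← hb, hp, hq, ← Nat.cast_add, card_filter_add_card_filter_not, card_univ]
  have ha' : a = p - q := by
    rw [← ha, ← sum_filter_add_sum_filter_not univ (fun j => ε j = 1),
      sum_congr rfl (g := fun _ => (1 : ℚ)) (by simp),
      sum_congr rfl (g := fun _ => (-1 : ℚ)) (fun j hj => hneg j (by simpa using hj))]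
    simp [hp, hq, sub_eq_add_neg]
  have hgeom (c : ℚ) : (1 - C c * X) * PowerSeries.mk (fun n => c ^ n) = 1 := by
    have := congrArg (rescale c) (mk_one_mul_one_sub_eq_one ℚ)
    simpa [rescale_mk, mul_comm, rescale_X] using this
  have hprod : ∏ j, PowerSeries.mk (fun n => ε j ^ n) =
      PowerSeries.binomialSeries ℚ (-(q : ℚ)) * rescale (-1 : ℚ) (PowerSeries.binomialSeries ℚ (-(p : ℚ))) := by
    have h1 : (1 + X) ^ q * PowerSeries.binomialSeries ℚ (-(q : ℚ)) = (1 : ℚ⟦X⟧) := by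
      rw [← binomialSeries_nat (R := ℚ), ← binomialSeries_add]
      simp
    have h2 : (1 - X) ^ p * rescale (-1 : ℚ) (PowerSeries.binomialSeries ℚ (-(p : ℚ))) = (1 : ℚ⟦X⟧) := by
      have h : (1 + X) ^ p * PowerSeries.binomialSeries ℚ (-(p : ℚ)) = (1 : ℚ⟦X⟧) := by
        rw [← binomialSeries_nat (R := ℚ), ← binomialSeries_add]
        simp
      have := congrArg (rescale (-1 : ℚ)) h
      simpa [rescale_X, sub_eq_add_neg] using this
    have h3 : (1 + X) ^ q * (1 - X) ^ p * ∏ j, PowerSeries.mk (fun n => ε j ^ n)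
        = (1 : ℚ⟦X⟧) := by
      have : ((1 + X) ^ q * (1 - X) ^ p : ℚ⟦X⟧) = ∏ j, (1 - C (ε j) * X) := by
        rw [← prod_filter_mul_prod_filter_not univ (fun j => ε j = 1),
          prod_congr rfl (g := fun _ => (1 - X : ℚ⟦X⟧)) (by simp +contextual),
          prod_congr (s₁ := univ.filter fun j => ¬ ε j = 1) rfl (g := fun _ => (1 + X : ℚ⟦X⟧))
            (fun j hj => by rw [hneg j (by simpa using hj)]; simp), prod_const, prod_const,
          mul_comm]
      rw [this, ← prod_mul_distrib]
      exact prod_eq_one fun j _ => hgeom _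
    calc _ = ((1 + X) ^ q * PowerSeries.binomialSeries ℚ (-(q : ℚ))) *
          ((1 - X) ^ p * rescale (-1 : ℚ) (PowerSeries.binomialSeries ℚ (-(p : ℚ)))) *
          ∏ j, PowerSeries.mk (fun n => ε j ^ n) := by rw [h1, h2, one_mul, one_mul]
      _ = PowerSeries.binomialSeries ℚ (-(q : ℚ)) * rescale (-1 : ℚ) (PowerSeries.binomialSeries ℚ (-(p : ℚ))) *
          ((1 + X) ^ q * (1 - X) ^ p * ∏ j, PowerSeries.mk (fun n => ε j ^ n)) := by ring
      _ = _ := by rw [h3, mul_one]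
  rw [hprod, coeff_mul, Nat.sum_antidiagonal_eq_sum_range_succ_mk]
  refine sum_congr rfl fun i _ => ?_
  rw [show (a - b) / 2 = -(q : ℚ) by rw [ha', hb']; ring,
    show -(a + b) / 2 = -(p : ℚ) by rw [ha', hb']; ring]
  simp [coeff_rescale, mul_assoc]

theorem exists_comp_perm_eq_iff {α I : Type*} [Fintype α] (f g : α → I) :
    (∃ π : Perm α, f ∘ π = g) ↔ univ.val.map f = univ.val.map g := by
  classical
  constructor
  · rintro ⟨π, rfl⟩
    rw [← Multiset.map_map, Multiset.map_univ_val_equiv]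
  · intro h
    have hc (i : I) : Nonempty ({n // g n = i} ≃ {n // f n = i}) := by
      refine ⟨Fintype.equivOfCardEq ?_⟩
      have := congrArg (Multiset.count i) h
      rw [Multiset.count_map, Multiset.count_map] at this
      rw [Fintype.card_subtype, Fintype.card_subtype, card_def, card_def, filter_val, filter_val]
      simpa only [eq_comm] using this.symm
    refine ⟨Equiv.ofFiberEquiv fun i => (hc i).some, ?_⟩
    ext n
    exact Equiv.ofFiberEquiv_map _ _

/-- The unordered collection of values of a family. -/
def symOfFun {I : Type*} {m : ℕ} (f : Fin m → I) : Sym I m :=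
  ⟨univ.val.map f, by simp⟩

theorem symOfFun_surjective {I : Type*} {m : ℕ} :
    Function.Surjective (symOfFun : (Fin m → I) → Sym I m) := by
  rintro ⟨s, rfl⟩
  induction s using Quotient.inductionOn with
  | h l =>
    refine ⟨l.get, Subtype.ext ?_⟩
    change univ.val.map l.get = (l : Multiset I)
    rw [Fin.univ_val_map, List.ofFn_get]

theorem symOfFun_eq_iff {I : Type*} {m : ℕ} (f g : Fin m → I) :
    symOfFun f = symOfFun g ↔ ∃ π : Perm (Fin m), f ∘ π = g := by
  rw [exists_comp_perm_eq_iff]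
  exact Subtype.ext_iff

theorem prod_map_symOfFun {I : Type*} {m : ℕ} (f : Fin m → I) (ε : I → ℚ) :
    ((symOfFun f).1.map ε).prod = ∏ j, ε (f j) := by
  change ((univ.val.map f).map ε).prod = _
  rw [Multiset.map_map]
  rfl

theorem card_comp_perm_eq {I : Type*} [DecidableEq I] {m : ℕ} (f g : Fin m → I) :
    #{π : Perm (Fin m) | f ∘ π = g} =
      if symOfFun f = symOfFun g then #{π : Perm (Fin m) | g ∘ π = g} else 0 := by
  split_ifs with h
  · obtain ⟨π₀, rfl⟩ := (symOfFun_eq_iff _ _).1 h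
    refine card_equiv (Equiv.mulLeft π₀⁻¹) fun π => ?_
    simp only [mem_filter_univ, Equiv.coe_mulLeft]
    have : (f ∘ π₀) ∘ ⇑(π₀⁻¹ * π) = f ∘ π := by
      ext j
      simp
    rw [this]
  · rw [card_eq_zero, filter_eq_empty_iff]
    exact fun π _ hπ => h ((symOfFun_eq_iff _ _).2 ⟨π, hπ⟩)

/-- Orbit-stabilizer for the permutations acting on families with a given collection of values. -/
theorem sum_card_stabilizer {I : Type*} [Fintype I] [DecidableEq I] {m : ℕ} (y : Sym I m) :
    ∑ f : Fin m → I with symOfFun f = y, #{π : Perm (Fin m) | f ∘ π = f} = m.factorial := by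
  obtain ⟨f₀, rfl⟩ := symOfFun_surjective y
  have h : ∀ f ∈ univ.filter (fun f : Fin m → I => symOfFun f = symOfFun f₀),
      #{π : Perm (Fin m) | f ∘ π = f} = #{π : Perm (Fin m) | f₀ ∘ π = f} := by
    intro f hf
    rw [card_comp_perm_eq f₀ f, if_pos (by simpa using (mem_filter_univ f |>.1 hf).symm)]
  rw [sum_congr rfl h, ← card_eq_sum_card_fiberwise]
  · simp [Fintype.card_perm]
  · intro π _
    simp only [coe_filter, mem_univ, true_and, Set.mem_ofPred_eq]
    exact ((symOfFun_eq_iff _ _).2 ⟨π, rfl⟩).symm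

theorem sum_perm_sum_invariant {I : Type*} [Fintype I] [DecidableEq I] {m : ℕ} (ε : I → ℚ) :
    ∑ π : Perm (Fin m), ∑ f : Fin m → I with f ∘ π = f, ∏ j, ε (f j) =
      m.factorial * ∑ y : Sym I m, (y.1.map ε).prod := by
  simp only [sum_filter]
  rw [sum_comm, ← sum_fiberwise univ (symOfFun : (Fin m → I) → Sym I m), mul_sum]
  refine sum_congr rfl fun y _ => ?_
  rw [← sum_card_stabilizer y, Nat.cast_sum, sum_mul]
  refine sum_congr rfl fun f hf => ?_
  rw [← (mem_filter_univ f).1 hf, prod_map_symOfFun, ← sum_filter, sum_const, nsmul_eq_mul]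

theorem sum_wreath_invariant {I : Type*} [Fintype I] [DecidableEq I] {k m : ℕ} (ε : I → ℚ)
    (ρ : Perm (Fin k)) :
    ∑ t : Fin k → Perm (Fin m), ∑ F : Fin k → Fin m → I with ∀ i, F (ρ i) ∘ t i = F i,
        ∏ i, ∏ j, ε (F i j) =
      m.factorial ^ k * ∑ Y : Fin k → Sym I m with Y ∘ ρ = Y, ∏ i, ((Y i).1.map ε).prod := by
  simp only [sum_filter]
  rw [sum_comm, ← sum_fiberwise univ
    (fun (F : Fin k → Fin m → I) i => (symOfFun (F i) : Sym I m)), mul_sum]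
  refine sum_congr rfl fun Y _ => ?_
  have hinner (F : Fin k → Fin m → I) (hF : (fun i => symOfFun (F i)) = Y) :
      (∑ t : Fin k → Perm (Fin m), if ∀ i, F (ρ i) ∘ t i = F i then ∏ i, ∏ j, ε (F i j) else 0)
        = if Y ∘ ρ = Y then (∏ i, ((Y i).1.map ε).prod) *
            ∏ i, (#{π : Perm (Fin m) | F i ∘ π = F i} : ℚ) else 0 := by
    have hcard : #{t : Fin k → Perm (Fin m) | ∀ i, F (ρ i) ∘ t i = F i} =
        ∏ i, #{π : Perm (Fin m) | F (ρ i) ∘ π = F i} := by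
      rw [← Fintype.card_piFinset]
      congr 1
      ext t
      simp
    rw [← sum_filter, sum_const, nsmul_eq_mul, hcard]
    simp only [card_comp_perm_eq (F (ρ _)) (F _)]
    subst hF
    simp only [prod_map_symOfFun]
    split_ifs with h
    · have hi (i : Fin k) : symOfFun (F (ρ i)) = symOfFun (F i) := congrFun h i
      simp only [hi, if_true]
      rw [Nat.cast_prod, mul_comm]
    · obtain ⟨i, hi⟩ := Function.ne_iff.1 h
      rw [prod_eq_zero (mem_univ i) (if_neg hi), Nat.cast_zero, zero_mul]
  rw [sum_congr rfl fun F hF => hinner F ((mem_filter_univ F).1 hF)]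
  split_ifs with h
  · rw [← mul_sum, mul_comm]
    congr 1
    have : univ.filter (fun F : Fin k → Fin m → I => (fun i => symOfFun (F i)) = Y) =
        Fintype.piFinset fun i => univ.filter fun f : Fin m → I => symOfFun f = Y i := by
      ext F
      simp [funext_iff]
    rw [this, ← prod_univ_sum (fun i => univ.filter fun f : Fin m → I => symOfFun f = Y i)
      (fun _ f => (#{π : Perm (Fin m) | f ∘ π = f} : ℚ))]
    simp only [← Nat.cast_sum, sum_card_stabilizer]
    simp
  · simp

theorem cycleIndex_top_eq_hsymm {I : Type*} [Fintype I] [DecidableEq I] {m : ℕ} (ε : I → ℚ) :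
    cycleIndex (⊤ : Subgroup (Perm (Fin m))) (fun r => ∑ i, ε i ^ r) =
      ∑ y : Sym I m, (y.1.map ε).prod := by
  have hm : (m.factorial : ℚ) ≠ 0 := Nat.cast_ne_zero.2 (Nat.factorial_ne_zero m)
  have hcard : Nat.card (⊤ : Subgroup (Perm (Fin m))) = m.factorial := by
    rw [Subgroup.card_top, Nat.card_perm, Nat.card_fin]
  rw [cycleIndex, hcard]
  simp only [← sum_invariant_colorings, Subgroup.mem_top, filter_true]
  have := sum_perm_sum_invariant (m := m) ε
  rw [one_div, inv_mul_eq_iff_eq_mul₀ hm, ← this]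
  congr!

theorem prodShear_injective {k m : ℕ} (hm : 1 ≤ m) :
    Function.Injective fun u : Perm (Fin k) × (Fin k → Perm (Fin m)) =>
      (Equiv.prodShear u.1 u.2 : Perm (Fin k × Fin m)) := by
  rintro ⟨ρ, t⟩ ⟨ρ', t'⟩ h
  have h' (i : Fin k) (j : Fin m) : (ρ i, t i j) = (ρ' i, t' i j) :=
    congrArg (fun σ : Perm (Fin k × Fin m) => σ (i, j)) h
  refine Prod.ext (Equiv.ext fun i => ?_) (funext fun i => Equiv.ext fun j => ?_)
  · exact congrArg Prod.fst (h' i ⟨0, hm⟩)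
  · exact congrArg Prod.snd (h' i j)

theorem mem_wreath_top_iff {k m : ℕ} (σ : Perm (Fin k × Fin m)) :
    σ ∈ wreath k m (⊤ : Subgroup (Perm (Fin m))) ↔
      ∃ u : Perm (Fin k) × (Fin k → Perm (Fin m)), Equiv.prodShear u.1 u.2 = σ := by
  constructor
  · rintro ⟨ρ, t, h⟩
    exact ⟨(ρ, fun i => t i), Equiv.ext fun x => (h x.1 x.2).symm⟩
  · rintro ⟨u, rfl⟩
    exact ⟨u.1, fun i => ⟨u.2 i, Subgroup.mem_top _⟩, fun i j => rfl⟩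

open scoped Classical in
theorem filter_mem_wreath_top {k m : ℕ} (hm : 1 ≤ m) :
    univ.filter (fun σ => σ ∈ wreath k m (⊤ : Subgroup (Perm (Fin m)))) =
      univ.map ⟨_, prodShear_injective (k := k) hm⟩ := by
  ext σ
  rw [mem_filter_univ, mem_wreath_top_iff]
  simp

theorem card_wreath_top {k m : ℕ} (hm : 1 ≤ m) :
    Nat.card (wreath k m (⊤ : Subgroup (Perm (Fin m)))) = k.factorial * m.factorial ^ k := by
  classical
  rw [Nat.card_eq_fintype_card, Fintype.card_subtype, filter_mem_wreath_top hm, card_map,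
    card_univ]
  simp [Fintype.card_perm]

theorem cycleIndex_wreath_eq_hsymm {I : Type*} [Fintype I] [DecidableEq I] {k m : ℕ}
    (hm : 1 ≤ m) (ε : I → ℚ) :
    cycleIndex (wreath k m (⊤ : Subgroup (Perm (Fin m)))) (fun r => ∑ i, ε i ^ r) =
      ∑ Y : Sym (Sym I m) k, (Y.1.map fun y => (y.1.map ε).prod).prod := by
  have hne : ((k.factorial * m.factorial ^ k : ℕ) : ℚ) ≠ 0 :=
    Nat.cast_ne_zero.2 (mul_ne_zero (Nat.factorial_ne_zero k)
      (pow_ne_zero _ (Nat.factorial_ne_zero m)))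
  rw [cycleIndex, card_wreath_top hm, one_div, inv_mul_eq_iff_eq_mul₀ hne,
    filter_mem_wreath_top hm, sum_map, Fintype.sum_prod_type]
  simp only [← sum_invariant_colorings, Function.Embedding.coeFn_mk]
  have hcurry (ρ : Perm (Fin k)) (t : Fin k → Perm (Fin m)) :
      ∑ f : Fin k × Fin m → I with f ∘ (Equiv.prodShear ρ t) = f, ∏ n, ε (f n) =
        ∑ F : Fin k → Fin m → I with ∀ i, F (ρ i) ∘ t i = F i, ∏ i, ∏ j, ε (F i j) := by
    refine sum_equiv (Equiv.curry _ _ _) (fun f => ?_) fun f _ => ?_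
    · simp [funext_iff]
    · rw [Fintype.prod_prod_type]
      rfl
  have hρ (ρ : Perm (Fin k)) := sum_wreath_invariant (m := m) ε ρ
  have hsum := sum_perm_sum_invariant (m := k) (fun y : Sym I m => (y.1.map ε).prod)
  calc _ = ∑ ρ : Perm (Fin k), ∑ t : Fin k → Perm (Fin m),
        ∑ F : Fin k → Fin m → I with ∀ i, F (ρ i) ∘ t i = F i, ∏ i, ∏ j, ε (F i j) := by
        refine sum_congr rfl fun ρ _ => sum_congr rfl fun t _ => ?_
        rw [← hcurry]
        congr!
    _ = _ := by
        rw [sum_congr rfl fun ρ _ => hρ ρ, ← mul_sum, hsum]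
        push_cast
        ring

theorem neg_one_pow_mul_choose_neg_natCast (n m : ℕ) :
    (-1 : ℚ) ^ m * Ring.choose (-(n : ℚ)) m = n.multichoose m := by
  have h : Ring.choose ((n : ℚ) + m - 1) m = n.multichoose m := by
    rcases Nat.eq_zero_or_pos (n + m) with h0 | hpos
    · obtain ⟨rfl, rfl⟩ := Nat.add_eq_zero_iff.1 h0
      simp
    · rw [Nat.multichoose_eq, ← Ring.choose_natCast, Nat.cast_sub hpos, Nat.cast_add, Nat.cast_one]
  rw [Ring.choose_neg, h, Units.smul_def, zsmul_eq_mul, ← mul_assoc,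
    Int.cast_negOnePow_natCast, ← mul_pow]
  simp

theorem cycleIndex_wreath_of_natCast {k m : ℕ} (hm : 1 ≤ m) (p q : ℕ) (τ χ a b : ℚ)
    (hτ : τ = p - q) (hχ : χ = p + q)
    (ha : a = cycleIndex (⊤ : Subgroup (Perm (Fin m))) (fun r => if Odd r then τ else χ))
    (hb : b = (-1 : ℚ) ^ m * Ring.choose (-χ) m) :
    cycleIndex (wreath k m (⊤ : Subgroup (Perm (Fin m)))) (fun r => if Odd r then τ else χ) =
      ∑ i ∈ range (k + 1), Ring.choose ((a - b) / 2) i * (-1 : ℚ) ^ (k - i) *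
        Ring.choose (-(a + b) / 2) (k - i) := by
  set ε : Fin p ⊕ Fin q → ℚ := Sum.elim (fun _ => 1) (fun _ => -1) with hεdef
  have hε (i) : ε i = 1 ∨ ε i = -1 := by rcases i with i | i <;> simp [hεdef]
  have hx : (fun r => if Odd r then τ else χ) = fun r : ℕ => ∑ i, ε i ^ r := by
    ext r
    simp only [hεdef, Fintype.sum_sum_type, Sum.elim_inl, Sum.elim_inr, sum_const, card_univ,
      Fintype.card_fin, one_pow, nsmul_eq_mul, mul_one]
    split_ifs with h
    · rw [h.neg_one_pow, hτ]; ring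
    · rw [(Nat.not_odd_iff_even.1 h).neg_one_pow, hχ]; ring
  rw [hx, cycleIndex_top_eq_hsymm] at ha
  rw [hx, cycleIndex_wreath_eq_hsymm hm, hsymm_eq_coeff_prod]
  refine coeff_prod_signs _ (fun y => ?_) k a b ha.symm ?_
  · refine Multiset.prod_induction (fun c : ℚ => c = 1 ∨ c = -1) _ ?_ (Or.inl rfl) ?_
    · rintro c d (rfl | rfl) (rfl | rfl) <;> simp
    · intro c hc
      obtain ⟨i, _, rfl⟩ := Multiset.mem_map.1 hc
      exact hε i
  · rw [hb, hχ, ← Nat.cast_add, neg_one_pow_mul_choose_neg_natCast, Sym.card_sym_eq_multichoose,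
      Fintype.card_sum, Fintype.card_fin, Fintype.card_fin]

/-- Functions given by a polynomial in the coordinates. -/
noncomputable def mvPolynomialFunctions (σ : Type*) : Subalgebra ℚ ((σ → ℚ) → ℚ) :=
  (AlgHom.pi fun v : σ → ℚ => (MvPolynomial.aeval v : MvPolynomial σ ℚ →ₐ[ℚ] ℚ)).range

theorem mem_mvPolynomialFunctions {σ : Type*} {f : (σ → ℚ) → ℚ} :
    f ∈ mvPolynomialFunctions σ ↔ ∃ P : MvPolynomial σ ℚ, ∀ v, MvPolynomial.eval v P = f v := by
  simp [mvPolynomialFunctions, AlgHom.mem_range, funext_iff]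

theorem proj_mem_mvPolynomialFunctions {σ : Type*} (s : σ) :
    (fun v : σ → ℚ => v s) ∈ mvPolynomialFunctions σ :=
  mem_mvPolynomialFunctions.2 ⟨MvPolynomial.X s, by simp⟩

theorem const_mem_mvPolynomialFunctions {σ : Type*} (c : ℚ) :
    (fun _ : σ → ℚ => c) ∈ mvPolynomialFunctions σ :=
  (mvPolynomialFunctions σ).algebraMap_mem c

theorem choose_mem_mvPolynomialFunctions {σ : Type*} {f : (σ → ℚ) → ℚ}
    (hf : f ∈ mvPolynomialFunctions σ) (n : ℕ) :
    (fun v => Ring.choose (f v) n) ∈ mvPolynomialFunctions σ := by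
  have h : (fun v => Ring.choose (f v) n) =
      (n.factorial : ℚ)⁻¹ • Polynomial.aeval f (descPochhammer ℤ n) := by
    ext v
    rw [Ring.choose_eq_smul, ← Polynomial.aeval_eq_smeval, Pi.smul_apply]
    exact congrArg _ (Polynomial.aeval_algHom_apply (Pi.evalAlgHom ℤ _ v) f _)
  rw [h, Polynomial.aeval_eq_sum_range]
  exact Subalgebra.smul_mem _ (sum_mem fun i _ => zsmul_mem (pow_mem hf i) _) _

theorem cycleIndex_mem_mvPolynomialFunctions {σ α : Type*} [Fintype α] [DecidableEq α]
    (G : Subgroup (Perm α)) {f g : (σ → ℚ) → ℚ} (hf : f ∈ mvPolynomialFunctions σ)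
    (hg : g ∈ mvPolynomialFunctions σ) :
    (fun v => cycleIndex G fun r => if Odd r then f v else g v) ∈ mvPolynomialFunctions σ := by
  classical
  have h : (fun v => cycleIndex G fun r => if Odd r then f v else g v) =
      (1 / (Nat.card G : ℚ)) • ∑ π ∈ univ.filter (fun π => π ∈ G),
        ∏ k ∈ Icc 1 (Fintype.card α), (if Odd k then f else g) ^ cycCount π k := by
    ext v
    simp only [cycleIndex, Pi.smul_apply, smul_eq_mul, Finset.sum_apply, Finset.prod_apply,
      Pi.pow_apply]
    congr! 4
    split_ifs <;> rfl
  rw [h]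
  refine Subalgebra.smul_mem _ (Subalgebra.sum_mem _ fun π _ => Subalgebra.prod_mem _ fun k _ =>
    Subalgebra.pow_mem _ ?_ _) _
  split_ifs
  exacts [hf, hg]

theorem eq_of_mem_mvPolynomialFunctions {σ : Type*} [Finite σ] {f g : (σ → ℚ) → ℚ}
    (hf : f ∈ mvPolynomialFunctions σ) (hg : g ∈ mvPolynomialFunctions σ)
    (h : ∀ n : σ → ℕ, f (fun s => n s) = g (fun s => n s)) : f = g := by
  obtain ⟨P, hP⟩ := mem_mvPolynomialFunctions.1 hf
  obtain ⟨Q, hQ⟩ := mem_mvPolynomialFunctions.1 hg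
  have hPQ : P = Q := by
    refine MvPolynomial.funext_set (fun _ => Set.range ((↑) : ℕ → ℚ))
      (fun _ => Set.infinite_range_of_injective Nat.cast_injective) fun v hv => ?_
    choose n hn using fun s => hv s (Set.mem_univ s)
    obtain rfl : (fun s => (n s : ℚ)) = v := funext hn
    rw [hP, hQ, h]
  ext v
  rw [← hP, ← hQ, hPQ]

/-- combinatorial form of the Hirzebruch-type formula: with
`a = Z(S_m; τ, χ, τ, χ, …)` and `b = (−1)^m · Ring.choose(−χ, m)`,
`Z(S_k ≀ S_m; τ, χ, τ, χ, …) = Σ_{i=0}^{k} Ring.choose((a−b)/2, i) · (−1)^{k−i} ·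
Ring.choose(−(a+b)/2, k−i)`, i.e. the coefficient of `t^k` in
`(1−t²)^{(1/2)(−1)^{m+1}·Ring.choose(−χ, m)} · ((1+t)/(1−t))^{a/2}`. -/
theorem cycleIndex_wreath_hirzebruch (k m : ℕ) (hk : 1 ≤ k) (hm : 1 ≤ m) (τ χ : ℚ)
    (a b : ℚ)
    (ha : a = cycleIndex (⊤ : Subgroup (Equiv.Perm (Fin m)))
      (fun r => if Odd r then τ else χ))
    (hb : b = (-1 : ℚ) ^ m * Ring.choose (-χ) m) :
    cycleIndex (wreath k m (⊤ : Subgroup (Equiv.Perm (Fin m))))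
        (fun r => if Odd r then τ else χ) =
      ∑ i ∈ Finset.range (k + 1),
        Ring.choose ((a - b) / 2) i * (-1 : ℚ) ^ (k - i) *
          Ring.choose (-(a + b) / 2) (k - i) := by
  set T : (Fin 2 → ℚ) → ℚ := fun v => v 0 - v 1 with hT
  set X : (Fin 2 → ℚ) → ℚ := fun v => v 0 + v 1 with hX
  set A : (Fin 2 → ℚ) → ℚ := fun v =>
    cycleIndex (⊤ : Subgroup (Perm (Fin m))) (fun r => if Odd r then T v else X v) with hA
  set B : (Fin 2 → ℚ) → ℚ := fun v => (-1 : ℚ) ^ m * Ring.choose (-X v) m with hB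
  have hTm : T ∈ mvPolynomialFunctions (Fin 2) :=
    sub_mem (proj_mem_mvPolynomialFunctions 0) (proj_mem_mvPolynomialFunctions 1)
  have hXm : X ∈ mvPolynomialFunctions (Fin 2) :=
    add_mem (proj_mem_mvPolynomialFunctions 0) (proj_mem_mvPolynomialFunctions 1)
  have hAm : A ∈ mvPolynomialFunctions (Fin 2) := cycleIndex_mem_mvPolynomialFunctions _ hTm hXm
  have hBm : B ∈ mvPolynomialFunctions (Fin 2) :=
    mul_mem (const_mem_mvPolynomialFunctions _) (choose_mem_mvPolynomialFunctions (neg_mem hXm) m)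
  have hhalf {f : (Fin 2 → ℚ) → ℚ} (hf : f ∈ mvPolynomialFunctions (Fin 2)) :
      (fun v => f v / 2) ∈ mvPolynomialFunctions (Fin 2) := by
    simp only [div_eq_mul_inv]
    exact mul_mem hf (const_mem_mvPolynomialFunctions _)
  have hL := cycleIndex_mem_mvPolynomialFunctions
    (wreath k m (⊤ : Subgroup (Perm (Fin m)))) hTm hXm
  have hR : (fun v => ∑ i ∈ range (k + 1), Ring.choose ((A v - B v) / 2) i *
      (-1 : ℚ) ^ (k - i) * Ring.choose (-(A v + B v) / 2) (k - i)) ∈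
      mvPolynomialFunctions (Fin 2) := by
    rw [show (fun v => ∑ i ∈ range (k + 1), Ring.choose ((A v - B v) / 2) i *
      (-1 : ℚ) ^ (k - i) * Ring.choose (-(A v + B v) / 2) (k - i)) =
      ∑ i ∈ range (k + 1), fun v => Ring.choose ((A v - B v) / 2) i *
      (-1 : ℚ) ^ (k - i) * Ring.choose (-(A v + B v) / 2) (k - i) by
        ext v; rw [Finset.sum_apply]]
    refine sum_mem fun i _ => mul_mem (mul_mem ?_ (const_mem_mvPolynomialFunctions _)) ?_
    · exact choose_mem_mvPolynomialFunctions (hhalf (sub_mem hAm hBm)) i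
    · exact choose_mem_mvPolynomialFunctions (hhalf (neg_mem (add_mem hAm hBm))) (k - i)
  have key := congrFun (eq_of_mem_mvPolynomialFunctions hL hR fun n =>
    cycleIndex_wreath_of_natCast hm (n 0) (n 1) _ _ _ _ rfl rfl rfl rfl)
    ![(χ + τ) / 2, (χ - τ) / 2]
  have hTv : T ![(χ + τ) / 2, (χ - τ) / 2] = τ := by
    simp [hT]; ring
  have hXv : X ![(χ + τ) / 2, (χ - τ) / 2] = χ := by
    simp [hX]; ring
  simpa only [hA, hB, hTv, hXv, ← ha, ← hb] using key
end
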